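/- arXiv:2012.04988 — 2 statements merged into one kernel-verified Lean document; each statement's English description precedes it below -/
import Mathlib

section
/- For every a > 0, ∫_ℝ cos(ax)/((x^2+1)(x^4+1)) dx = (π/2)(e^{-a} + √2 e^{-a/√2} sin(a/√2)). -/
open MeasureTheory Real

open scoped FourierTransform

lemma integrable_and_integral_exp_mul_exp_neg_mul_abs {c : ℂ} (hc : 0 < c.re) (w : ℝ) :
    Integrable (fun t : ℝ => Complex.exp (w * t * Complex.I) * Complex.exp (-(c * |t|))) ∧
      ∫ t : ℝ, Complex.exp (w * t * Complex.I) * Complex.exp (-(c * |t|))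
        = 2 * c / (c ^ 2 + w ^ 2) := by
  have hIic : Set.EqOn (fun t : ℝ => Complex.exp ((c + w * Complex.I) * t))
      (fun t : ℝ => Complex.exp (w * t * Complex.I) * Complex.exp (-(c * |t|)))
      (Set.Iic 0) := by
    intro t ht
    simp only [abs_of_nonpos (Set.mem_Iic.mp ht), ← Complex.exp_add]
    push_cast
    ring_nf
  have hIoi : Set.EqOn (fun t : ℝ => Complex.exp ((-c + w * Complex.I) * t))
      (fun t : ℝ => Complex.exp (w * t * Complex.I) * Complex.exp (-(c * |t|)))
      (Set.Ioi 0) := by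
    intro t ht
    simp only [abs_of_pos (Set.mem_Ioi.mp ht), ← Complex.exp_add]
    ring_nf
  have hl : 0 < (c + w * Complex.I).re := by simpa using hc
  have hr : (-c + w * Complex.I).re < 0 := by simpa using hc
  have intIic := (integrableOn_exp_mul_complex_Iic hl 0).congr_fun hIic measurableSet_Iic
  have intIoi := (integrableOn_exp_mul_complex_Ioi hr 0).congr_fun hIoi measurableSet_Ioi
  have hl0 : c + w * Complex.I ≠ 0 := fun h => by simp [h] at hl
  have hr0 : -c + w * Complex.I ≠ 0 := fun h => by simp [h] at hr
  have hprod : c ^ 2 + (w : ℂ) ^ 2 = -((c + w * Complex.I) * (-c + w * Complex.I)) := by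
    linear_combination (w : ℂ) ^ 2 * Complex.I_sq
  constructor
  · rw [← integrableOn_univ, ← Set.Iic_union_Ioi (a := (0 : ℝ))]
    exact intIic.union intIoi
  · rw [← intervalIntegral.integral_Iic_add_Ioi intIic intIoi,
      ← setIntegral_congr_fun measurableSet_Iic hIic,
      ← setIntegral_congr_fun measurableSet_Ioi hIoi,
      integral_exp_mul_complex_Iic hl, integral_exp_mul_complex_Ioi hr, hprod]
    simp only [Complex.ofReal_zero, mul_zero, Complex.exp_zero]
    field_simp
    ring

/-- The function whose Fourier transform is proportional to `1 / ((x ^ 2 + 1) * (x ^ 4 + 1))`. -/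
noncomputable def expSinKernel (t : ℝ) : ℂ :=
  (Real.exp (-|t|) + √2 * Real.exp (-(|t| / √2)) * Real.sin (|t| / √2) : ℝ)

lemma continuous_expSinKernel : Continuous expSinKernel := by
  unfold expSinKernel
  fun_prop

lemma expSinKernel_eq (t : ℝ) :
    expSinKernel t = Complex.exp (-((1 : ℂ) * |t|))
      + (-(Complex.I * (√2 / 2))) * Complex.exp (-((√2 / 2 * (1 - Complex.I)) * |t|))
      + Complex.I * (√2 / 2) * Complex.exp (-((√2 / 2 * (1 + Complex.I)) * |t|)) := by
  have hs : |t| / √2 = √2 / 2 * |t| := by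
    have h2 : √2 * √2 = 2 := Real.mul_self_sqrt (by norm_num)
    field_simp
    linear_combination -|t| * h2
  have h1 : -(((√2 : ℂ) / 2 * (1 - Complex.I)) * |t|)
      = -(√2 / 2 * |t|) + (√2 / 2 * |t|) * Complex.I := by ring
  have h2 : -(((√2 : ℂ) / 2 * (1 + Complex.I)) * |t|)
      = -(√2 / 2 * |t|) + -(√2 / 2 * |t|) * Complex.I := by ring
  rw [expSinKernel, hs, h1, h2, Complex.exp_add, Complex.exp_add]
  push_cast
  rw [Complex.sin]
  ring_nf

lemma integrable_and_integral_exp_mul_expSinKernel (w : ℝ) :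
    Integrable (fun t : ℝ => Complex.exp (w * t * Complex.I) * expSinKernel t) ∧
      ∫ t : ℝ, Complex.exp (w * t * Complex.I) * expSinKernel t
        = (4 / ((w ^ 2 + 1) * (w ^ 4 + 1)) : ℝ) := by
  obtain ⟨i1, e1⟩ := integrable_and_integral_exp_mul_exp_neg_mul_abs (c := 1) (by simp) w
  obtain ⟨i2, e2⟩ := integrable_and_integral_exp_mul_exp_neg_mul_abs
    (c := √2 / 2 * (1 - Complex.I)) (by simp) w
  obtain ⟨i3, e3⟩ := integrable_and_integral_exp_mul_exp_neg_mul_abs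
    (c := √2 / 2 * (1 + Complex.I)) (by simp) w
  have heq : (fun t : ℝ => Complex.exp (w * t * Complex.I) * expSinKernel t) = fun t : ℝ =>
      Complex.exp (w * t * Complex.I) * Complex.exp (-((1 : ℂ) * |t|))
      + (-(Complex.I * (√2 / 2))) * (Complex.exp (w * t * Complex.I) *
          Complex.exp (-((√2 / 2 * (1 - Complex.I)) * |t|)))
      + Complex.I * (√2 / 2) * (Complex.exp (w * t * Complex.I) *
          Complex.exp (-((√2 / 2 * (1 + Complex.I)) * |t|))) := by
    funext t
    rw [expSinKernel_eq]
    ring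
  have j2 := i2.const_mul (-(Complex.I * (√2 / 2)))
  have j3 := i3.const_mul (Complex.I * (√2 / 2))
  rw [heq]
  refine ⟨(i1.add j2).add j3, ?_⟩
  rw [integral_add ?_ j3, integral_add i1 j2, integral_const_mul, integral_const_mul, e1, e2, e3]
  swap
  · exact i1.add j2
  have h2 : (√2 : ℂ) ^ 2 = 2 := by exact_mod_cast Real.sq_sqrt (by norm_num : (0 : ℝ) ≤ 2)
  have hI := Complex.I_sq
  have s2 : ((√2 : ℂ) / 2 * (1 - Complex.I)) ^ 2 = -Complex.I := by
    linear_combination (1 - Complex.I) ^ 2 / 4 * h2 + hI / 2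
  have s3 : ((√2 : ℂ) / 2 * (1 + Complex.I)) ^ 2 = Complex.I := by
    linear_combination (1 + Complex.I) ^ 2 / 4 * h2 + hI / 2
  have hA : (w : ℂ) ^ 2 + 1 ≠ 0 := by
    exact_mod_cast (by positivity : w ^ 2 + 1 ≠ 0)
  have hB : (w : ℂ) ^ 4 + 1 ≠ 0 := by
    exact_mod_cast (by positivity : w ^ 4 + 1 ≠ 0)
  have hprod : (-Complex.I + (w : ℂ) ^ 2) * (Complex.I + (w : ℂ) ^ 2) = (w : ℂ) ^ 4 + 1 := by
    linear_combination -hI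
  have hm : -Complex.I + (w : ℂ) ^ 2 ≠ 0 := left_ne_zero_of_mul (hprod ▸ hB)
  have hp : Complex.I + (w : ℂ) ^ 2 ≠ 0 := right_ne_zero_of_mul (hprod ▸ hB)
  have k2 : -(Complex.I * ((√2 : ℂ) / 2)) * (2 * (√2 / 2 * (1 - Complex.I)) /
      (-Complex.I + (w : ℂ) ^ 2))
      = -(Complex.I + 1) * (Complex.I + (w : ℂ) ^ 2) / ((w : ℂ) ^ 4 + 1) := by
    rw [← hprod]
    field_simp
    linear_combination (-Complex.I * (1 - Complex.I)) * h2 + 2 * hI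
  have k3 : Complex.I * ((√2 : ℂ) / 2) * (2 * (√2 / 2 * (1 + Complex.I)) /
      (Complex.I + (w : ℂ) ^ 2))
      = (Complex.I - 1) * (-Complex.I + (w : ℂ) ^ 2) / ((w : ℂ) ^ 4 + 1) := by
    rw [← hprod]
    field_simp
    linear_combination (Complex.I * (1 + Complex.I)) * h2 + 2 * hI
  rw [s2, s3, k2, k3]
  push_cast
  rw [one_pow, add_comm (1 : ℂ)]
  field_simp
  linear_combination (-2 * ((w : ℂ) ^ 2 + 1)) * hI

lemma integrable_four_div_sq_add_one_mul_pow_four_add_one :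
    Integrable fun x : ℝ => 4 / ((x ^ 2 + 1) * (x ^ 4 + 1)) := by
  refine (integrable_inv_one_add_sq.const_mul 4).mono'
    (Continuous.aestronglyMeasurable (by fun_prop (disch := intros; positivity)))
    (.of_forall fun x => ?_)
  rw [Real.norm_of_nonneg (by positivity), div_eq_mul_inv, add_comm (1 : ℝ)]
  gcongr
  exact le_mul_of_one_le_right (by positivity) (by linarith [show 0 ≤ x ^ 4 by positivity])

lemma fourier_expSinKernel (w : ℝ) :
    𝓕 expSinKernel w
      = (4 / (((2 * π * w) ^ 2 + 1) * ((2 * π * w) ^ 4 + 1)) : ℝ) := by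
  have h := (integrable_and_integral_exp_mul_expSinKernel (-(2 * π * w))).2
  rw [neg_pow_two, Even.neg_pow (by decide : Even 4)] at h
  rw [Real.fourier_real_eq_integral_exp_smul, ← h]
  refine integral_congr_ae (.of_forall fun t => ?_)
  simp only [smul_eq_mul]
  congr 2
  push_cast
  ring

lemma integral_exp_mul_I_eq_expSinKernel (a : ℝ) :
    ∫ x : ℝ, Complex.exp ((a * x : ℝ) * Complex.I) *
      (4 / ((x ^ 2 + 1) * (x ^ 4 + 1)) : ℝ) = 2 * π * expSinKernel a := by
  have hint : Integrable expSinKernel := by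
    simpa using (integrable_and_integral_exp_mul_expSinKernel 0).1
  have hF : 𝓕 expSinKernel = fun w : ℝ =>
      ((4 / (((2 * π * w) ^ 2 + 1) * ((2 * π * w) ^ 4 + 1)) : ℝ) : ℂ) :=
    funext fourier_expSinKernel
  have hFint : Integrable (𝓕 expSinKernel) := by
    rw [hF]
    exact (integrable_four_div_sq_add_one_mul_pow_four_add_one.comp_mul_left'
      (by positivity : 2 * π ≠ 0)).ofReal
  have hinv := congrFun (continuous_expSinKernel.fourierInv_fourier_eq hint hFint) a
  rw [Real.fourierInv_eq', hF] at hinv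
  have hsub := Measure.integral_comp_mul_left (fun x : ℝ =>
    Complex.exp ((a * x : ℝ) * Complex.I) * (4 / ((x ^ 2 + 1) * (x ^ 4 + 1)) : ℝ)) (2 * π)
  have hcomp : (∫ x : ℝ, Complex.exp ((a * (2 * π * x) : ℝ) * Complex.I) *
      (4 / (((2 * π * x) ^ 2 + 1) * ((2 * π * x) ^ 4 + 1)) : ℝ)) = expSinKernel a := by
    rw [← hinv]
    congr 1 with x
    simp only [smul_eq_mul, RCLike.inner_apply, conj_trivial]
    congr 4
    ring
  rw [← hcomp, hsub, abs_of_pos (by positivity), Complex.real_smul, ← mul_assoc]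
  push_cast
  rw [mul_inv_cancel₀ (by simp), one_mul]

theorem stmt_11 (a : ℝ) (ha : 0 < a) :
    ∫ x : ℝ, Real.cos (a * x) / ((x ^ 2 + 1) * (x ^ 4 + 1))
      = (Real.pi / 2) * (Real.exp (-a)
        + Real.sqrt 2 * Real.exp (-(a / Real.sqrt 2)) * Real.sin (a / Real.sqrt 2)) := by
  have hint : Integrable fun x : ℝ => Complex.exp ((a * x : ℝ) * Complex.I) *
      ((4 / ((x ^ 2 + 1) * (x ^ 4 + 1)) : ℝ) : ℂ) :=
    integrable_four_div_sq_add_one_mul_pow_four_add_one.ofReal.bdd_mul (c := 1)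
      (Continuous.aestronglyMeasurable (by fun_prop))
      (.of_forall fun x => (Complex.norm_exp_ofReal_mul_I _).le)
  have hre := integral_re hint
  rw [integral_exp_mul_I_eq_expSinKernel, expSinKernel, abs_of_pos ha] at hre
  have hcos : ∀ x : ℝ, RCLike.re (Complex.exp ((a * x : ℝ) * Complex.I) *
      ((4 / ((x ^ 2 + 1) * (x ^ 4 + 1)) : ℝ) : ℂ))
      = 4 * (Real.cos (a * x) / ((x ^ 2 + 1) * (x ^ 4 + 1))) := fun x => by
    rw [RCLike.re_eq_complex_re, Complex.re_mul_ofReal, Complex.exp_ofReal_mul_I_re]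
    ring
  simp_rw [hcos] at hre
  rw [integral_const_mul, RCLike.re_eq_complex_re, ← Complex.ofReal_ofNat, ← Complex.ofReal_mul,
    ← Complex.ofReal_mul, Complex.ofReal_re] at hre
  linear_combination hre / 4
end

section
/- For every a > 0, ∫_ℝ x·sin(ax)/((x^2+1)(x^4+1)) dx = (π/2)(e^{-a} - e^{-a/√2} cos(a/√2) + e^{-a/√2} sin(a/√2)). -/
open MeasureTheory Real

open scoped FourierTransform

/-- The odd extension to `ℝ` of the function `t ↦ exp (-α t)` on the positive half-line. -/
noncomputable def oddExp (α : ℂ) (t : ℝ) : ℂ :=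
  if 0 < t then Complex.exp (-α * t) else -Complex.exp (α * t)

lemma oddExp_of_pos (α : ℂ) {t : ℝ} (ht : 0 < t) : oddExp α t = Complex.exp (-α * t) :=
  if_pos ht

lemma oddExp_of_nonpos (α : ℂ) {t : ℝ} (ht : t ≤ 0) : oddExp α t = -Complex.exp (α * t) :=
  if_neg ht.not_gt

lemma continuousAt_oddExp (α : ℂ) {t : ℝ} (ht : 0 < t) : ContinuousAt (oddExp α) t := by
  have h : ContinuousAt (fun s : ℝ => Complex.exp (-α * s)) t := by fun_prop
  refine h.congr ?_
  filter_upwards [lt_mem_nhds ht] with s hs using (oddExp_of_pos α hs).symm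

lemma integrable_oddExp {α : ℂ} (hα : 0 < α.re) : Integrable (oddExp α) := by
  rw [← integrableOn_univ, ← Set.Iic_union_Ioi (a := (0 : ℝ))]
  refine IntegrableOn.union ?_ ?_
  · exact (integrableOn_exp_mul_complex_Iic hα 0).neg.congr_fun
      (fun t ht => (oddExp_of_nonpos α ht).symm) measurableSet_Iic
  · exact (integrableOn_exp_mul_complex_Ioi (a := -α) (by simpa using hα) 0).congr_fun
      (fun t ht => (oddExp_of_pos α ht).symm) measurableSet_Ioi

lemma integral_cexp_mul_oddExp {α : ℂ} (hα : 0 < α.re) (u : ℝ) :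
    ∫ t : ℝ, Complex.exp (-(u * Complex.I) * t) * oddExp α t
      = 1 / (α + u * Complex.I) - 1 / (α - u * Complex.I) := by
  have hneg : Set.EqOn (fun t : ℝ => -Complex.exp ((α - u * Complex.I) * t))
      (fun t : ℝ => Complex.exp (-(u * Complex.I) * t) * oddExp α t) (Set.Iic 0) := by
    intro t ht
    simp only [oddExp_of_nonpos α ht, mul_neg, ← Complex.exp_add]
    ring_nf
  have hpos : Set.EqOn (fun t : ℝ => Complex.exp (-(α + u * Complex.I) * t))
      (fun t : ℝ => Complex.exp (-(u * Complex.I) * t) * oddExp α t) (Set.Ioi 0) := by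
    intro t ht
    simp only [oddExp_of_pos α ht, ← Complex.exp_add]
    ring_nf
  have hre_neg : 0 < (α - u * Complex.I).re := by simpa using hα
  have hre_pos : (-(α + u * Complex.I)).re < 0 := by simpa using hα
  rw [← intervalIntegral.integral_Iic_add_Ioi (b := 0)
    ((integrableOn_exp_mul_complex_Iic hre_neg 0).neg.congr_fun hneg measurableSet_Iic)
    ((integrableOn_exp_mul_complex_Ioi hre_pos 0).congr_fun hpos measurableSet_Ioi),
    ← setIntegral_congr_fun measurableSet_Iic hneg,
    ← setIntegral_congr_fun measurableSet_Ioi hpos, integral_neg,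
    integral_exp_mul_complex_Iic hre_neg, integral_exp_mul_complex_Ioi hre_pos]
  simp only [Complex.ofReal_zero, mul_zero, Complex.exp_zero, neg_div_neg_eq]
  ring

lemma fourier_oddExp {α : ℂ} (hα : 0 < α.re) (ξ : ℝ) :
    𝓕 (oddExp α) ξ = 1 / (α + (2 * π * ξ : ℝ) * Complex.I)
      - 1 / (α - (2 * π * ξ : ℝ) * Complex.I) := by
  rw [fourier_real_eq_integral_exp_smul, ← integral_cexp_mul_oddExp hα]
  congr 1 with t
  rw [smul_eq_mul]
  congr 2
  push_cast
  ring

/-- The primitive eighth root of unity `exp (-iπ/4)`. -/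
noncomputable def eighthRoot : ℂ := ⟨1 / √2, -(1 / √2)⟩

lemma eighthRoot_sq : eighthRoot ^ 2 = -Complex.I := by
  have h : (√2)⁻¹ * (√2)⁻¹ = 1 / 2 := by
    rw [← mul_inv, Real.mul_self_sqrt (by norm_num)]; norm_num
  apply Complex.ext <;> simp [eighthRoot, pow_two, h]
  norm_num

lemma conj_eighthRoot_sq : (starRingEnd ℂ eighthRoot) ^ 2 = Complex.I := by
  rw [← map_pow, eighthRoot_sq]; simp

/-- The inverse Fourier transform of a multiple of `x / ((x ^ 2 + 1) * (x ^ 4 + 1))`. -/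
noncomputable def oddExpSum (t : ℝ) : ℂ :=
  oddExp 1 t + (-1 - Complex.I) / 2 * oddExp eighthRoot t
    + (-1 + Complex.I) / 2 * oddExp (starRingEnd ℂ eighthRoot) t

lemma eighthRoot_re_pos : 0 < eighthRoot.re := by simp [eighthRoot]

lemma conj_eighthRoot_re_pos : 0 < (starRingEnd ℂ eighthRoot).re := by simp [eighthRoot]

lemma integrable_oddExpSum : Integrable oddExpSum :=
  ((integrable_oddExp (by simp)).add ((integrable_oddExp eighthRoot_re_pos).const_mul _)).add
    ((integrable_oddExp conj_eighthRoot_re_pos).const_mul _)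

lemma continuousAt_oddExpSum {t : ℝ} (ht : 0 < t) : ContinuousAt oddExpSum t :=
  ((continuousAt_oddExp _ ht).add (continuousAt_const.mul (continuousAt_oddExp _ ht))).add
    (continuousAt_const.mul (continuousAt_oddExp _ ht))

lemma one_div_add_sub_one_div_sub {α : ℂ} (hα : 0 < α.re) (u : ℝ) :
    α ^ 2 + u ^ 2 ≠ 0 ∧ 1 / (α + u * Complex.I) - 1 / (α - u * Complex.I)
      = -2 * u * Complex.I / (α ^ 2 + u ^ 2) := by
  have h₁ : α + u * Complex.I ≠ 0 := fun h => by
    have := congrArg Complex.re h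
    simp at this; linarith
  have h₂ : α - u * Complex.I ≠ 0 := fun h => by
    have := congrArg Complex.re h
    simp at this; linarith
  have h₃ : α ^ 2 + u ^ 2 = (α + u * Complex.I) * (α - u * Complex.I) := by
    linear_combination (u : ℂ) ^ 2 * Complex.I_sq
  refine ⟨h₃ ▸ mul_ne_zero h₁ h₂, ?_⟩
  rw [h₃]
  field_simp
  ring

lemma fourier_oddExpSum (ξ : ℝ) :
    𝓕 oddExpSum ξ = -4 * Complex.I *
      ((2 * π * ξ / (((2 * π * ξ) ^ 2 + 1) * ((2 * π * ξ) ^ 4 + 1)) : ℝ) : ℂ) := by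
  have i₁ : Integrable (oddExp 1) := integrable_oddExp (by simp)
  have i₂ := (integrable_oddExp eighthRoot_re_pos).const_mul ((-1 - Complex.I) / 2)
  have i₃ := (integrable_oddExp conj_eighthRoot_re_pos).const_mul ((-1 + Complex.I) / 2)
  have hsum : 𝓕 oddExpSum ξ = 𝓕 (oddExp 1) ξ + (-1 - Complex.I) / 2 * 𝓕 (oddExp eighthRoot) ξ
      + (-1 + Complex.I) / 2 * 𝓕 (oddExp (starRingEnd ℂ eighthRoot)) ξ := by
    have key : ∀ {f : ℝ → ℂ}, Integrable f →
        Integrable fun t : ℝ => Complex.exp (↑(-2 * π * t * ξ) * Complex.I) * f t := by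
      intro f hf
      refine hf.bdd_mul (c := 1) (Continuous.aestronglyMeasurable (by fun_prop)) ?_
      exact Filter.Eventually.of_forall fun t => (Complex.norm_exp_ofReal_mul_I _).le
    simp only [fourier_real_eq_integral_exp_smul, smul_eq_mul, ← integral_const_mul]
    rw [← integral_add (key i₁), ← integral_add]
    · congr 1 with t
      simp only [oddExpSum]
      ring
    · refine (key i₁).add ((key i₂).congr ?_)
      exact Filter.Eventually.of_forall fun t => by ring
    · refine (key i₃).congr ?_
      exact Filter.Eventually.of_forall fun t => by ring
    · refine (key i₂).congr ?_
      exact Filter.Eventually.of_forall fun t => by ring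
  rw [hsum, fourier_oddExp (by simp), fourier_oddExp eighthRoot_re_pos,
    fourier_oddExp conj_eighthRoot_re_pos]
  generalize 2 * π * ξ = u
  obtain ⟨n₁, e₁⟩ := one_div_add_sub_one_div_sub (α := 1) (by simp) u
  obtain ⟨n₂, e₂⟩ := one_div_add_sub_one_div_sub eighthRoot_re_pos u
  obtain ⟨n₃, e₃⟩ := one_div_add_sub_one_div_sub conj_eighthRoot_re_pos u
  rw [e₁, e₂, e₃]
  rw [eighthRoot_sq] at n₂ ⊢
  rw [conj_eighthRoot_sq] at n₃ ⊢
  rw [one_pow] at n₁ ⊢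
  have h : (u : ℂ) ^ 4 + 1 = (-Complex.I + u ^ 2) * (Complex.I + u ^ 2) := by
    linear_combination Complex.I_sq
  push_cast
  rw [h, add_comm ((u : ℂ) ^ 2) 1]
  field_simp
  ring_nf
  simp only [Complex.I_sq]
  ring

lemma integrable_div_sq_add_one_mul :
    Integrable fun x : ℝ => x / ((x ^ 2 + 1) * (x ^ 4 + 1)) := by
  refine integrable_inv_one_add_sq.mono' ?_ (Filter.Eventually.of_forall fun x => ?_)
  · refine (Continuous.div (by fun_prop) (by fun_prop) fun x => ?_).aestronglyMeasurable
    positivity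
  · have hx : |x| ≤ x ^ 4 + 1 := by
      rw [abs_le]
      constructor <;> nlinarith [sq_nonneg (x ^ 2 - 1 / 2), sq_nonneg (x + 1 / 2),
        sq_nonneg (x - 1 / 2)]
    have h₂ : 0 < x ^ 2 + 1 := by positivity
    have h₄ : 0 < x ^ 4 + 1 := by positivity
    rw [Real.norm_eq_abs, abs_div, abs_of_pos (mul_pos h₂ h₄), add_comm 1, inv_eq_one_div,
      div_le_div_iff₀ (mul_pos h₂ h₄) h₂]
    nlinarith

lemma integrable_fourier_oddExpSum : Integrable (𝓕 oddExpSum) := by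
  rw [funext fourier_oddExpSum]
  exact ((integrable_div_sq_add_one_mul.comp_mul_left'
    (by positivity : 2 * π ≠ 0)).ofReal (𝕜 := ℂ)).const_mul _

lemma re_oddExpSum {a : ℝ} (ha : 0 < a) :
    (oddExpSum a).re = exp (-a) - exp (-(a / √2)) * cos (a / √2)
      + exp (-(a / √2)) * sin (a / √2) := by
  simp [oddExpSum, oddExp_of_pos _ ha, eighthRoot, Complex.exp_re, Complex.exp_im, inv_mul_eq_div]
  ring

lemma re_integral_eq_re_oddExpSum {a : ℝ} (ha : 0 < a) :
    (2 * π)⁻¹ * (4 * ∫ x : ℝ, x * sin (a * x) / ((x ^ 2 + 1) * (x ^ 4 + 1)))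
      = (oddExpSum a).re := by
  have hinv := integrable_oddExpSum.fourierInv_fourier_eq integrable_fourier_oddExpSum
    (continuousAt_oddExpSum ha)
  set F : ℝ → ℂ := fun x => Complex.exp ((a * x : ℝ) * Complex.I) *
    (-4 * Complex.I * ((x / ((x ^ 2 + 1) * (x ^ 4 + 1)) : ℝ) : ℂ)) with hF
  have hFint : Integrable F := by
    refine Integrable.bdd_mul (c := 1) ?_ (Continuous.aestronglyMeasurable (by fun_prop)) ?_
    · exact (integrable_div_sq_add_one_mul.ofReal (𝕜 := ℂ)).const_mul _
    · exact Filter.Eventually.of_forall fun t => (Complex.norm_exp_ofReal_mul_I _).le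
  have hscale : ∫ ξ : ℝ, F (2 * π * ξ) = oddExpSum a := by
    rw [← hinv, fourierInv_eq']
    congr 1 with ξ
    rw [fourier_oddExpSum, smul_eq_mul, hF]
    simp only [RCLike.inner_apply, conj_trivial]
    ring_nf
  have hre : (∫ x, F x).re = 4 * ∫ x : ℝ, x * sin (a * x) / ((x ^ 2 + 1) * (x ^ 4 + 1)) := by
    rw [← RCLike.re_to_complex, ← integral_re hFint, ← integral_const_mul]
    congr 1 with x
    rw [hF, RCLike.re_to_complex]
    simp only [Complex.exp_mul_I, ← Complex.ofReal_cos, ← Complex.ofReal_sin]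
    simp only [Complex.mul_re, Complex.mul_im, Complex.add_re, Complex.add_im, Complex.ofReal_re,
      Complex.ofReal_im, Complex.I_re, Complex.I_im, Complex.neg_re, Complex.neg_im,
      Complex.re_ofNat, Complex.im_ofNat]
    ring
  rw [← hscale, Measure.integral_comp_mul_left, abs_of_pos (by positivity), Complex.smul_re, hre,
    smul_eq_mul]

theorem stmt_12 (a : ℝ) (ha : 0 < a) :
    ∫ x : ℝ, x * Real.sin (a * x) / ((x ^ 2 + 1) * (x ^ 4 + 1))
      = (Real.pi / 2) * (Real.exp (-a)
        - Real.exp (-(a / Real.sqrt 2)) * Real.cos (a / Real.sqrt 2)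
        + Real.exp (-(a / Real.sqrt 2)) * Real.sin (a / Real.sqrt 2)) := by
  rw [← re_oddExpSum ha, ← re_integral_eq_re_oddExpSum ha]
  generalize ∫ x : ℝ, x * sin (a * x) / ((x ^ 2 + 1) * (x ^ 4 + 1)) = J
  field_simp
  ring
end
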